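/- arXiv:1604.04185 — 2 statements merged into one kernel-verified Lean document; each statement's English description precedes it below -/
import Mathlib

section
/- Let S^(0) be the n×n identity matrix and, for t ≥ 1, define S^(t) by S^(t)(i,j) = 1 if i = j and S^(t)(i,j) = (c/(|I(v_i)|·|I(v_j)|)) · Σ_{v_k ∈ I(v_i), v_ℓ ∈ I(v_j)} S^(t-1)(k,ℓ) otherwise. Then for every t ≥ 0 and all i,j, |S^(t)(i,j) − s(v_i,v_j)| ≤ c^(t+1)/(1−c); in particular, if t ≥ log_c(ε·(1−c)) − 1 for some ε ∈ (0,1), then |S^(t)(i,j) − s(v_i,v_j)| ≤ ε for all i,j. -/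
/-- Averaging over a product of two nonempty finsets and scaling by `c ≥ 0` sends functions bounded
by `M` to numbers bounded by `c * M`. -/
theorem abs_const_div_card_mul_sum_sum_le {α β : Type*} {A : Finset α} {B : Finset β}
    (hA : A.Nonempty) (hB : B.Nonempty) {c M : ℝ} (hc : 0 ≤ c) {f : α → β → ℝ}
    (hf : ∀ a b, |f a b| ≤ M) :
    |c / ((A.card : ℝ) * (B.card : ℝ)) * ∑ a ∈ A, ∑ b ∈ B, f a b| ≤ c * M := by
  have hA' : (0 : ℝ) < A.card := by exact_mod_cast hA.card_pos
  have hB' : (0 : ℝ) < B.card := by exact_mod_cast hB.card_pos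
  have hsum : |∑ a ∈ A, ∑ b ∈ B, f a b| ≤ A.card * (B.card * M) := by
    calc |∑ a ∈ A, ∑ b ∈ B, f a b| ≤ ∑ a ∈ A, ∑ b ∈ B, |f a b| :=
          (Finset.abs_sum_le_sum_abs _ _).trans
            (Finset.sum_le_sum fun a _ => Finset.abs_sum_le_sum_abs _ _)
      _ ≤ ∑ _a ∈ A, ∑ _b ∈ B, M :=
          Finset.sum_le_sum fun a _ => Finset.sum_le_sum fun b _ => hf a b
      _ = A.card * (B.card * M) := by simp
  rw [abs_mul, abs_of_nonneg (by positivity : 0 ≤ c / ((A.card : ℝ) * (B.card : ℝ)))]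
  calc c / ((A.card : ℝ) * (B.card : ℝ)) * |∑ a ∈ A, ∑ b ∈ B, f a b|
      ≤ c / ((A.card : ℝ) * (B.card : ℝ)) * (A.card * (B.card * M)) := by gcongr
    _ = c * M := by field_simp


/-- Let `S^(0)` be the identity and, for `t ≥ 1`, let `S^(t)` be
obtained from `S^(t-1)` by the power-method iteration for SimRank. Then for every
`t ≥ 0` and all `i, j`, `|S^(t)(i,j) − s(v_i, v_j)| ≤ c^(t+1)/(1−c)`; in particular,
if `t ≥ log_c (ε (1−c)) − 1` for some `ε ∈ (0,1)`, then
`|S^(t)(i,j) − s(v_i, v_j)| ≤ ε` for all `i, j`. -/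
theorem power_method_error_bound
    (n : ℕ) (In : Fin n → Finset (Fin n)) (hIn : ∀ v, (In v).Nonempty)
    (c : ℝ) (hc0 : 0 < c) (hc1 : c < 1)
    (s : Fin n → Fin n → ℝ)
    (hs0 : ∀ i j, 0 ≤ s i j) (hs1 : ∀ i j, s i j ≤ 1)
    (hsdiag : ∀ i, s i i = 1)
    (hsoff : ∀ i j, i ≠ j →
      s i j = c / (((In i).card : ℝ) * ((In j).card : ℝ)) *
        ∑ a ∈ In i, ∑ b ∈ In j, s a b)
    (S : ℕ → Fin n → Fin n → ℝ)
    (hS0 : ∀ i j, i ≠ j → S 0 i j = 0)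
    (hSdiag : ∀ t i, S t i i = 1)
    (hSrec : ∀ t i j, i ≠ j →
      S (t + 1) i j = c / (((In i).card : ℝ) * ((In j).card : ℝ)) *
        ∑ a ∈ In i, ∑ b ∈ In j, S t a b) :
    (∀ (t : ℕ) (i j : Fin n), |S t i j - s i j| ≤ c ^ (t + 1) / (1 - c)) ∧
    (∀ ε : ℝ, 0 < ε → ε < 1 → ∀ t : ℕ, Real.logb c (ε * (1 - c)) - 1 ≤ (t : ℝ) →
      ∀ i j : Fin n, |S t i j - s i j| ≤ ε) := by
  have hpow : ∀ (t : ℕ) (i j : Fin n), |S t i j - s i j| ≤ c ^ (t + 1) := by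
    intro t
    induction t with
    | zero =>
      intro i j
      by_cases hij : i = j
      · subst hij
        simp [hSdiag, hsdiag, hc0.le]
      · rw [hS0 i j hij, zero_sub, abs_neg, hsoff i j hij]
        simpa using abs_const_div_card_mul_sum_sum_le (hIn i) (hIn j) hc0.le
          (fun a b => abs_le.2 ⟨by linarith [hs0 a b], hs1 a b⟩)
    | succ t ih =>
      intro i j
      by_cases hij : i = j
      · subst hij
        rw [hSdiag, hsdiag, sub_self, abs_zero]
        positivity
      · rw [hSrec t i j hij, hsoff i j hij, ← mul_sub, pow_succ']
        simp only [← Finset.sum_sub_distrib]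
        exact abs_const_div_card_mul_sum_sum_le (hIn i) (hIn j) hc0.le ih
  have hc : 0 < 1 - c := by linarith
  have hbound : ∀ (t : ℕ) (i j : Fin n), |S t i j - s i j| ≤ c ^ (t + 1) / (1 - c) := fun t i j =>
    (hpow t i j).trans (le_div_self (by positivity) hc (by linarith))
  refine ⟨hbound, fun ε hε _ t ht i j => (hbound t i j).trans ?_⟩
  rw [div_le_iff₀ hc, ← Real.rpow_natCast]
  refine (Real.logb_le_iff_le_rpow_of_base_lt_one hc0 hc1 (by positivity)).1 ?_
  push_cast
  linarith
end

section
/- Let c ∈ (0,1), ε_d ≥ 0, θ ≥ 0, and fix ℓ ≥ 0. Let (e^(t))_{0 ≤ t ≤ ℓ} be nonnegative reals with e^(0) ≤ (√c)^ℓ·ε_d + ((1−(√c)^ℓ)/(1−√c))·θ and e^(t+1) ≤ √c·e^(t) + (√c)^ℓ·θ for all 0 ≤ t < ℓ. Then e^(ℓ) ≤ c^ℓ·ε_d + 2(√c)^ℓ·((1−(√c)^ℓ)/(1−√c))·θ. Moreover, summing over ℓ, Σ_{ℓ=0}^∞ [ c^ℓ·ε_d + 2(√c)^ℓ·((1−(√c)^ℓ)/(1−√c))·θ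 ] = ε_d/(1−c) + (2√c/((1−c)(1−√c)))·θ. -/
/-- Iterating `e (t + 1) ≤ r * e t + b` gives the geometric-sum bound. -/
theorem le_geometric_of_le_affine {r b : ℝ} (hr : 0 ≤ r) (hr1 : r < 1) {n : ℕ} {e : ℕ → ℝ}
    (h : ∀ t < n, e (t + 1) ≤ r * e t + b) :
    ∀ t ≤ n, e t ≤ r ^ t * e 0 + (1 - r ^ t) / (1 - r) * b := by
  have hr' : 1 - r ≠ 0 := by linarith
  intro t
  induction t with
  | zero => intro _; simp
  | succ t ih =>
    intro ht
    calc e (t + 1) ≤ r * e t + b := h t ht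
      _ ≤ r * (r ^ t * e 0 + (1 - r ^ t) / (1 - r) * b) + b := by
        gcongr
        exact ih (by omega)
      _ = r ^ (t + 1) * e 0 + (1 - r ^ (t + 1)) / (1 - r) * b := by
        field_simp
        ring

/-- Let `c ∈ (0,1)`, `ε_d ≥ 0`, `θ ≥ 0`. (i) For any fixed `ℓ ≥ 0`,
if `(e^(t))_{0 ≤ t ≤ ℓ}` are nonnegative reals with
`e^(0) ≤ (√c)^ℓ·ε_d + ((1−(√c)^ℓ)/(1−√c))·θ` and
`e^(t+1) ≤ √c·e^(t) + (√c)^ℓ·θ` for all `0 ≤ t < ℓ`, then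
`e^(ℓ) ≤ c^ℓ·ε_d + 2(√c)^ℓ·((1−(√c)^ℓ)/(1−√c))·θ`. (ii) Moreover, summing over `ℓ`,
`Σ_{ℓ=0}^∞ [c^ℓ·ε_d + 2(√c)^ℓ·((1−(√c)^ℓ)/(1−√c))·θ]
  = ε_d/(1−c) + (2√c/((1−c)(1−√c)))·θ`. -/
theorem single_source_error_recurrence
    (c : ℝ) (hc0 : 0 < c) (hc1 : c < 1)
    (εd θ : ℝ) (hεd : 0 ≤ εd) (hθ : 0 ≤ θ) :
    (∀ (ℓ : ℕ) (e : ℕ → ℝ), (∀ t, 0 ≤ e t) →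
      e 0 ≤ Real.sqrt c ^ ℓ * εd + (1 - Real.sqrt c ^ ℓ) / (1 - Real.sqrt c) * θ →
      (∀ t, t < ℓ → e (t + 1) ≤ Real.sqrt c * e t + Real.sqrt c ^ ℓ * θ) →
      e ℓ ≤ c ^ ℓ * εd +
        2 * Real.sqrt c ^ ℓ * ((1 - Real.sqrt c ^ ℓ) / (1 - Real.sqrt c)) * θ) ∧
    HasSum
      (fun ℓ : ℕ => c ^ ℓ * εd +
        2 * Real.sqrt c ^ ℓ * ((1 - Real.sqrt c ^ ℓ) / (1 - Real.sqrt c)) * θ)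
      (εd / (1 - c) + 2 * Real.sqrt c / ((1 - c) * (1 - Real.sqrt c)) * θ) := by
  have hs0 : 0 ≤ Real.sqrt c := Real.sqrt_nonneg c
  have hs1 : Real.sqrt c < 1 := by rwa [Real.sqrt_lt' one_pos, one_pow]
  have hsc : Real.sqrt c ^ 2 = c := Real.sq_sqrt hc0.le
  have hpow (ℓ : ℕ) : c ^ ℓ = Real.sqrt c ^ ℓ * Real.sqrt c ^ ℓ := by
    rw [← mul_pow, ← sq, hsc]
  have hs1' : 1 - Real.sqrt c ≠ 0 := by linarith
  have hc1' : 1 - c ≠ 0 := by linarith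
  refine ⟨fun ℓ e _ h0 hstep => ?_, ?_⟩
  · calc e ℓ ≤ Real.sqrt c ^ ℓ * e 0 +
          (1 - Real.sqrt c ^ ℓ) / (1 - Real.sqrt c) * (Real.sqrt c ^ ℓ * θ) :=
          le_geometric_of_le_affine hs0 hs1 hstep ℓ le_rfl
      _ ≤ Real.sqrt c ^ ℓ *
            (Real.sqrt c ^ ℓ * εd + (1 - Real.sqrt c ^ ℓ) / (1 - Real.sqrt c) * θ) +
          (1 - Real.sqrt c ^ ℓ) / (1 - Real.sqrt c) * (Real.sqrt c ^ ℓ * θ) := by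
        gcongr
      _ = _ := by
        rw [hpow]
        ring
  · have hc := hasSum_geometric_of_lt_one hc0.le hc1
    have hs := hasSum_geometric_of_lt_one hs0 hs1
    have hval : εd / (1 - c) + 2 * Real.sqrt c / ((1 - c) * (1 - Real.sqrt c)) * θ =
        (1 - c)⁻¹ * εd + 2 * θ / (1 - Real.sqrt c) * ((1 - Real.sqrt c)⁻¹ - (1 - c)⁻¹) := by
      field_simp
      linear_combination -2 * θ * hsc
    rw [hval]
    refine ((hc.mul_right εd).add
      ((hs.sub hc).mul_left (2 * θ / (1 - Real.sqrt c)))).congr_fun fun ℓ => ?_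
    rw [hpow]
    ring
end
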